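/- arXiv:2005.13620 — 3 statements merged into one kernel-verified Lean document; each statement's English description precedes it below -/
import Mathlib

section
/- For |q| < 1, the double sum ∑_{n₁,n₂≥0} q^{n₁+n₂+n₁n₂} / ((q;q)_{n₁} (q;q)_{n₂}³) equals (∑_{n∈ℤ} sgn(n) q^{2n²+n}) / (q;q)_∞³, where sgn(0)=1. -/
/-- The finite q-Pochhammer symbol `(q;q)_n`. -/
noncomputable def qPoch (q : ℂ) (n : ℕ) : ℂ := ∏ i ∈ Finset.range n, (1 - q ^ (i + 1))

/-- The infinite q-Pochhammer symbol `(q;q)_∞`. -/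
noncomputable def qPochInf (q : ℂ) : ℂ := ∏' i : ℕ, (1 - q ^ (i + 1))

/-- The infinite q-Pochhammer symbol `(a;q)_∞ = ∏_{i≥0} (1 - a q^i)`. -/
noncomputable def pochInf (a q : ℂ) : ℂ := ∏' i : ℕ, (1 - a * q ^ i)

open Filter Topology in
theorem stmt2_pow_ne (q : ℂ) (hq : ‖q‖ < 1) (i : ℕ) : 1 - q ^ (i + 1) ≠ 0 := by
  intro h
  have h1 : q ^ (i + 1) = 1 := (sub_eq_zero.mp h).symm
  have h2 : ‖q‖ ^ (i + 1) = 1 := by rw [← norm_pow, h1, norm_one]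
  have h3 : ‖q‖ ^ (i + 1) < 1 := pow_lt_one₀ (norm_nonneg _) hq (Nat.succ_ne_zero _)
  linarith

theorem stmt2_poch_succ (q : ℂ) (n : ℕ) : qPoch q (n + 1) = qPoch q n * (1 - q ^ (n + 1)) := by
  simp [qPoch, Finset.prod_range_succ]

theorem stmt2_poch_zero (q : ℂ) : qPoch q 0 = 1 := by
  simp [qPoch]

theorem stmt2_poch_ne (q : ℂ) (hq : ‖q‖ < 1) (n : ℕ) : qPoch q n ≠ 0 :=
  Finset.prod_ne_zero_iff.mpr fun i _ => stmt2_pow_ne q hq i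

open Filter Topology in
theorem stmt2_summ (q : ℂ) (hq : ‖q‖ < 1) : Summable fun n : ℕ => q ^ n / qPoch q n := by
  obtain ⟨r, hr1, hr2⟩ := exists_between hq
  refine summable_of_ratio_norm_eventually_le (r := r) hr2 ?_
  have h0 : Tendsto (fun n : ℕ => q ^ (n + 1)) atTop (𝓝 0) :=
    (tendsto_pow_atTop_nhds_zero_of_norm_lt_one hq).comp (tendsto_add_atTop_nat 1)
  have h1 : Tendsto (fun n : ℕ => ‖q / (1 - q ^ (n + 1))‖) atTop (𝓝 ‖q / (1 - 0)‖) :=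
    (tendsto_const_nhds.div (tendsto_const_nhds.sub h0) (by simp)).norm
  rw [sub_zero, div_one] at h1
  filter_upwards [h1.eventually_lt_const hr1] with n hn
  have : q ^ (n + 1) / qPoch q (n + 1) = (q / (1 - q ^ (n + 1))) * (q ^ n / qPoch q n) := by
    have := stmt2_pow_ne q hq n
    have := stmt2_poch_ne q hq n
    rw [stmt2_poch_succ]
    field_simp
    ring
  rw [this, norm_mul]
  gcongr

noncomputable def stmt2F (q : ℂ) (m : ℕ) : ℂ := ∑' n : ℕ, q ^ (n * (m + 1)) / qPoch q n

theorem stmt2_bd (q : ℂ) (hq : ‖q‖ < 1) (m n : ℕ) :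
    ‖q ^ (n * (m + 1)) / qPoch q n‖ ≤ ‖q ^ n / qPoch q n‖ := by
  rw [norm_div, norm_div, norm_pow, norm_pow]
  gcongr ?_ / _
  exact pow_le_pow_of_le_one (norm_nonneg _) hq.le (by nlinarith)

theorem stmt2_Fsumm (q : ℂ) (hq : ‖q‖ < 1) (m : ℕ) :
    Summable fun n : ℕ => q ^ (n * (m + 1)) / qPoch q n :=
  Summable.of_norm_bounded (stmt2_summ q hq).norm (stmt2_bd q hq m)

theorem stmt2_Fsucc (q : ℂ) (hq : ‖q‖ < 1) (m : ℕ) :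
    stmt2F q (m + 1) = (1 - q ^ (m + 1)) * stmt2F q m := by
  have h1 : stmt2F q m - stmt2F q (m + 1) = q ^ (m + 1) * stmt2F q m := by
    unfold stmt2F
    rw [← (stmt2_Fsumm q hq m).tsum_sub (stmt2_Fsumm q hq (m + 1)),
      ((stmt2_Fsumm q hq m).sub (stmt2_Fsumm q hq (m + 1))).tsum_eq_zero_add, ← tsum_mul_left]
    simp only [zero_mul, pow_zero, sub_self, zero_add]
    refine tsum_congr fun n => ?_
    have := stmt2_pow_ne q hq n
    have := stmt2_poch_ne q hq n
    rw [stmt2_poch_succ]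
    field_simp
    ring
  linear_combination -h1

theorem stmt2_F (q : ℂ) (hq : ‖q‖ < 1) (m : ℕ) : stmt2F q m = qPoch q m * stmt2F q 0 := by
  induction m with
  | zero => simp [stmt2_poch_zero]
  | succ m ih => rw [stmt2_Fsucc q hq, ih, stmt2_poch_succ]; ring

open Filter Topology in
theorem stmt2_powlim (q : ℂ) (hq : ‖q‖ < 1) (n : ℕ) (hn : n ≠ 0) :
    Tendsto (fun m : ℕ => q ^ (n * (m + 1))) atTop (𝓝 0) := by
  refine (tendsto_pow_atTop_nhds_zero_of_norm_lt_one hq).comp ?_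
  refine tendsto_atTop_mono (fun m => ?_) tendsto_id
  have : 1 ≤ n := Nat.one_le_iff_ne_zero.mpr hn
  simp only [id]
  nlinarith

open Filter Topology in
theorem stmt2_Flim (q : ℂ) (hq : ‖q‖ < 1) : Tendsto (stmt2F q) atTop (𝓝 1) := by
  have h := tendsto_tsum_of_dominated_convergence (𝓕 := atTop)
    (f := fun m n : ℕ => q ^ (n * (m + 1)) / qPoch q n)
    (g := fun n : ℕ => if n = 0 then (1 : ℂ) else 0) (stmt2_summ q hq).norm
    (fun n => by
      rcases eq_or_ne n 0 with rfl | hn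
      · simp [stmt2_poch_zero]
      · simpa [hn] using (stmt2_powlim q hq n hn).div_const (qPoch q n))
    (Eventually.of_forall fun m n => stmt2_bd q hq m n)
  rw [tsum_ite_eq] at h
  exact h

open Filter Topology in
theorem stmt2_pochlim (q : ℂ) (hq : ‖q‖ < 1) : Tendsto (qPoch q) atTop (𝓝 (qPochInf q)) := by
  have hs : Summable fun i : ℕ => ‖-q ^ (i + 1)‖ := by
    simp only [norm_neg, norm_pow]
    exact (summable_nat_add_iff 1).mpr (summable_geometric_of_lt_one (norm_nonneg _) hq)
  have := (multipliable_one_add_of_summable hs).hasProd.tendsto_prod_nat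
  simp only [← sub_eq_add_neg] at this
  exact this

theorem stmt2_F0 (q : ℂ) (hq : ‖q‖ < 1) : qPochInf q * stmt2F q 0 = 1 := by
  have h1 := (stmt2_pochlim q hq).mul_const (stmt2F q 0)
  simp only [← stmt2_F q hq] at h1
  exact tendsto_nhds_unique h1 (stmt2_Flim q hq)

theorem stmt2_Inf_ne (q : ℂ) (hq : ‖q‖ < 1) : qPochInf q ≠ 0 :=
  left_ne_zero_of_mul_eq_one (stmt2_F0 q hq)

theorem stmt2_Fval (q : ℂ) (hq : ‖q‖ < 1) (m : ℕ) :
    stmt2F q m = qPoch q m / qPochInf q := by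
  have := stmt2_Inf_ne q hq
  rw [stmt2_F q hq, eq_div_iff this, mul_assoc, mul_comm (stmt2F q 0), stmt2_F0 q hq, mul_one]

theorem stmt2_C (q : ℂ) (hq : ‖q‖ < 1) : ∃ C : ℝ, 0 ≤ C ∧ ∀ n, ‖(qPoch q n)⁻¹‖ ≤ C := by
  have h := ((stmt2_pochlim q hq).inv₀ (stmt2_Inf_ne q hq)).norm
  obtain ⟨C, hC⟩ := h.bddAbove_range
  have hC' : ∀ n, ‖(qPoch q n)⁻¹‖ ≤ C := fun n => hC ⟨n, rfl⟩
  exact ⟨C, (norm_nonneg _).trans (hC' 0), hC'⟩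

noncomputable def stmt2g (q : ℂ) (m k : ℕ) : ℂ :=
  (-1) ^ k * q ^ (k.choose 2) * q ^ (k * (m + 1)) / qPoch q k

noncomputable def stmt2G (q : ℂ) (m : ℕ) : ℂ := ∑' k : ℕ, stmt2g q m k

theorem stmt2_gbd (q : ℂ) (hq : ‖q‖ < 1) (m k : ℕ) :
    ‖stmt2g q m k‖ ≤ ‖q ^ k / qPoch q k‖ := by
  refine le_trans ?_ (stmt2_bd q hq m k)
  unfold stmt2g
  rw [norm_div, norm_div, norm_mul, norm_mul, norm_pow, norm_neg, norm_one, one_pow, one_mul]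
  gcongr ?_ / _
  refine mul_le_of_le_one_left (norm_nonneg _) ?_
  rw [norm_pow]
  exact pow_le_one₀ (norm_nonneg _) hq.le

theorem stmt2_gsumm (q : ℂ) (hq : ‖q‖ < 1) (m : ℕ) : Summable (stmt2g q m) :=
  Summable.of_norm_bounded (stmt2_summ q hq).norm (stmt2_gbd q hq m)

theorem stmt2_ch (k : ℕ) : (k + 1).choose 2 = k + k.choose 2 := by
  rw [Nat.choose_succ_succ' k 1, Nat.choose_one_right]

theorem stmt2_Gsucc (q : ℂ) (hq : ‖q‖ < 1) (m : ℕ) :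
    stmt2G q m = (1 - q ^ (m + 1)) * stmt2G q (m + 1) := by
  have h1 : stmt2G q m - stmt2G q (m + 1) = -q ^ (m + 1) * stmt2G q (m + 1) := by
    unfold stmt2G
    rw [← (stmt2_gsumm q hq m).tsum_sub (stmt2_gsumm q hq (m + 1)),
      ((stmt2_gsumm q hq m).sub (stmt2_gsumm q hq (m + 1))).tsum_eq_zero_add, ← tsum_mul_left]
    have h0 : stmt2g q m 0 - stmt2g q (m + 1) 0 = 0 := by simp [stmt2g]
    rw [h0, zero_add]
    refine tsum_congr fun n => ?_
    have := stmt2_pow_ne q hq n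
    have := stmt2_poch_ne q hq n
    unfold stmt2g
    rw [stmt2_poch_succ, stmt2_ch]
    field_simp
    ring
  linear_combination h1

open Filter Topology in
theorem stmt2_Glim (q : ℂ) (hq : ‖q‖ < 1) : Tendsto (stmt2G q) atTop (𝓝 1) := by
  have h := tendsto_tsum_of_dominated_convergence (𝓕 := atTop)
    (f := stmt2g q)
    (g := fun n : ℕ => if n = 0 then (1 : ℂ) else 0) (stmt2_summ q hq).norm
    (fun n => by
      rcases eq_or_ne n 0 with rfl | hn
      · simp [stmt2_poch_zero, stmt2g]
      · simpa [hn, stmt2g] using ((stmt2_powlim q hq n hn).const_mul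
          ((-1) ^ n * q ^ (n.choose 2))).div_const (qPoch q n))
    (Eventually.of_forall fun m n => stmt2_gbd q hq m n)
  rw [tsum_ite_eq] at h
  exact h

theorem stmt2_G (q : ℂ) (hq : ‖q‖ < 1) (m : ℕ) : stmt2G q 0 = qPoch q m * stmt2G q m := by
  induction m with
  | zero => simp [stmt2_poch_zero]
  | succ m ih => rw [ih, stmt2_Gsucc q hq m, stmt2_poch_succ]; ring

theorem stmt2_G0 (q : ℂ) (hq : ‖q‖ < 1) : stmt2G q 0 = qPochInf q := by
  have h1 := (stmt2_pochlim q hq).mul (stmt2_Glim q hq)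
  simp only [← stmt2_G q hq, mul_one] at h1
  exact tendsto_nhds_unique tendsto_const_nhds h1

theorem stmt2_Gval (q : ℂ) (hq : ‖q‖ < 1) (m : ℕ) :
    (qPoch q m)⁻¹ = stmt2G q m / qPochInf q := by
  have h1 := stmt2_poch_ne q hq m
  have h2 := stmt2_Inf_ne q hq
  have h3 := stmt2_G q hq m
  rw [stmt2_G0 q hq] at h3
  rw [inv_eq_one_div, div_eq_div_iff h1 h2, h3]
  ring

theorem stmt2_mid (q : ℂ) (hq : ‖q‖ < 1) :
    ∑' n : ℕ, q ^ n / qPoch q n ^ 2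
      = (∑' k : ℕ, (-1) ^ k * q ^ ((k + 1).choose 2)) / qPochInf q ^ 2 := by
  have h2 := stmt2_Inf_ne q hq
  have e1 : ∀ n : ℕ, q ^ n / qPoch q n ^ 2
      = (∑' k : ℕ, q ^ n / qPoch q n * stmt2g q n k) / qPochInf q := by
    intro n
    rw [tsum_mul_left]
    have := stmt2_Gval q hq n
    unfold stmt2G at this
    rw [mul_div_assoc, ← this]
    have h1 := stmt2_poch_ne q hq n
    field_simp
  have hs : Summable (Function.uncurry fun n k : ℕ => q ^ n / qPoch q n * stmt2g q n k) := by
    have hp := (stmt2_summ q hq).norm.mul_of_nonneg (stmt2_summ q hq).norm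
      (fun _ => norm_nonneg _) (fun _ => norm_nonneg _)
    refine Summable.of_norm_bounded hp fun p => ?_
    simp only [Function.uncurry]
    rw [norm_mul]
    exact mul_le_mul_of_nonneg_left (stmt2_gbd q hq _ _) (norm_nonneg _)
  rw [tsum_congr e1, tsum_div_const, ← hs.tsum_comm, pow_two, ← div_div]
  congr 1
  rw [← tsum_div_const]
  refine tsum_congr fun k => ?_
  have h1 := stmt2_poch_ne q hq k
  have e2 : ∀ n : ℕ, q ^ n / qPoch q n * stmt2g q n k
      = ((-1) ^ k * q ^ ((k + 1).choose 2) / qPoch q k) * (q ^ (n * (k + 1)) / qPoch q n) := by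
    intro n
    have h3 := stmt2_poch_ne q hq n
    unfold stmt2g
    rw [stmt2_ch]
    field_simp
    ring
  rw [tsum_congr e2, tsum_mul_left]
  have := stmt2_Fval q hq k
  unfold stmt2F at this
  rw [this]
  field_simp

theorem stmt2_thsumm (q : ℂ) (hq : ‖q‖ < 1) :
    Summable fun k : ℕ => (-1 : ℂ) ^ k * q ^ ((k + 1).choose 2) := by
  refine Summable.of_norm_bounded (summable_geometric_of_lt_one (norm_nonneg _) hq) fun k => ?_
  rw [norm_mul, norm_pow, norm_neg, norm_one, one_pow, one_mul, norm_pow]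
  exact pow_le_pow_of_le_one (norm_nonneg _) hq.le (by rw [stmt2_ch]; omega)

theorem stmt2_ch_even (n : ℕ) : (2 * n + 1).choose 2 = 2 * n ^ 2 + n := by
  rw [Nat.choose_two_right]
  refine Nat.div_eq_of_eq_mul_left two_pos ?_
  simp only [Nat.add_sub_cancel]; ring

theorem stmt2_ch_odd (n : ℕ) : (2 * n + 1 + 1).choose 2 = 2 * n ^ 2 + 3 * n + 1 := by
  rw [stmt2_ch, stmt2_ch_even]; ring

theorem stmt2_hsc {f g : ℕ → ℂ} {a : ℂ} (h : HasSum f a) (e : ∀ n, g n = f n) : HasSum g a := by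
  rw [funext e]
  exact h

theorem stmt2_theta (q : ℂ) (hq : ‖q‖ < 1) :
    ∑' n : ℤ, (if 0 ≤ n then (1 : ℂ) else -1) * q ^ (2 * n ^ 2 + n).toNat
      = ∑' k : ℕ, (-1) ^ k * q ^ ((k + 1).choose 2) := by
  have hs := stmt2_thsumm q hq
  have he : Summable fun n : ℕ => q ^ (2 * n ^ 2 + n) := by
    refine (hs.comp_injective (i := fun n : ℕ => 2 * n) (fun a b h => by simpa using h)).congr ?_
    intro n
    simp only [Function.comp, stmt2_ch_even, pow_mul, neg_one_sq, one_pow, one_mul]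
  have ho : Summable fun n : ℕ => -q ^ (2 * n ^ 2 + 3 * n + 1) := by
    refine (hs.comp_injective (i := fun n : ℕ => 2 * n + 1)
      (fun a b h => by simpa using h)).congr ?_
    intro n
    simp only [Function.comp, stmt2_ch_odd]
    rw [pow_succ (-1 : ℂ), pow_mul, neg_one_sq, one_pow, one_mul, neg_one_mul]
  have hR : ∑' k : ℕ, (-1) ^ k * q ^ ((k + 1).choose 2)
      = ∑' n : ℕ, q ^ (2 * n ^ 2 + n) + ∑' n : ℕ, -q ^ (2 * n ^ 2 + 3 * n + 1) := by
    refine (HasSum.even_add_odd ?_ ?_).tsum_eq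
    · refine stmt2_hsc he.hasSum ?_
      intro n
      simp only [stmt2_ch_even, pow_mul, neg_one_sq, one_pow, one_mul]
    · refine stmt2_hsc ho.hasSum ?_
      intro n
      simp only [stmt2_ch_odd]
      rw [pow_succ (-1 : ℂ), pow_mul, neg_one_sq, one_pow, one_mul, neg_one_mul]
  rw [hR]
  refine (HasSum.of_nat_of_neg_add_one ?_ ?_).tsum_eq
  · refine stmt2_hsc he.hasSum ?_
    intro n
    have h1 : (2 * (n : ℤ) ^ 2 + n) = ((2 * n ^ 2 + n : ℕ) : ℤ) := by push_cast; ring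
    rw [h1, Int.toNat_natCast, if_pos (Int.natCast_nonneg n), one_mul]
  · refine stmt2_hsc ho.hasSum ?_
    intro n
    have h1 : (2 * (-((n : ℤ) + 1)) ^ 2 + -((n : ℤ) + 1))
        = ((2 * n ^ 2 + 3 * n + 1 : ℕ) : ℤ) := by push_cast; ring
    have h0 : ¬ (0 ≤ -((n : ℤ) + 1)) := by omega
    rw [h1, Int.toNat_natCast, if_neg h0, neg_one_mul]

theorem stmt2 (q : ℂ) (hq : ‖q‖ < 1) :
    ∑' n : ℕ × ℕ, q ^ (n.1 + n.2 + n.1 * n.2) / (qPoch q n.1 * qPoch q n.2 ^ 3)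
      = (∑' n : ℤ, (if 0 ≤ n then (1 : ℂ) else -1) * q ^ (2 * n ^ 2 + n).toNat)
          / qPochInf q ^ 3 := by
  have h2 := stmt2_Inf_ne q hq
  rw [stmt2_theta q hq]
  obtain ⟨C, hC0, hC⟩ := stmt2_C q hq
  have hs : Summable (fun n : ℕ × ℕ =>
      q ^ (n.1 + n.2 + n.1 * n.2) / (qPoch q n.1 * qPoch q n.2 ^ 3)) := by
    have hg := summable_geometric_of_lt_one (norm_nonneg _) hq
    have hp := (hg.mul_of_nonneg hg (fun _ => by positivity) (fun _ => by positivity)).mul_left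
      (C * C ^ 3)
    refine Summable.of_norm_bounded hp fun p => ?_
    rw [div_eq_inv_mul, norm_mul, mul_inv, norm_mul, ← inv_pow, norm_pow, norm_pow, ← pow_add]
    have hpow : ‖q‖ ^ (p.1 + p.2 + p.1 * p.2) ≤ ‖q‖ ^ (p.1 + p.2) :=
      pow_le_pow_of_le_one (norm_nonneg _) hq.le (Nat.le_add_right _ _)
    have h1 := hC p.1
    have h2 := hC p.2
    refine mul_le_mul (mul_le_mul h1 (pow_le_pow_left₀ (norm_nonneg _) h2 3) ?_ hC0) hpow ?_ ?_ <;>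
      positivity
  have hs' := (Equiv.prodComm ℕ ℕ).summable_iff.mpr hs
  rw [← (Equiv.prodComm ℕ ℕ).tsum_eq]
  have hP := Summable.tsum_prod hs'
  simp only [Function.comp, Equiv.prodComm_apply, Prod.swap] at hP
  have e : ∀ b : ℕ, ∑' a : ℕ, q ^ (a + b + a * b) / (qPoch q a * qPoch q b ^ 3)
      = q ^ b / qPoch q b ^ 2 / qPochInf q := by
    intro b
    have h1 := stmt2_poch_ne q hq b
    have e2 : ∀ a : ℕ, q ^ (a + b + a * b) / (qPoch q a * qPoch q b ^ 3)
        = q ^ b / qPoch q b ^ 3 * (q ^ (a * (b + 1)) / qPoch q a) := by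
      intro a
      have h3 := stmt2_poch_ne q hq a
      field_simp
      ring
    rw [tsum_congr e2, tsum_mul_left]
    have := stmt2_Fval q hq b
    unfold stmt2F at this
    rw [this]
    field_simp
  simp only [Equiv.prodComm_apply, Prod.swap]
  rw [hP, tsum_congr e, tsum_div_const, stmt2_mid q hq]
  field_simp
end

section
/- For |q| < 1, the 6-fold sum ∑_{n₁,…,n₆≥0} q^{n₁+⋯+n₆+n₁n₂+n₂n₃+n₃n₄+n₄n₅+n₅n₆} / ((q;q)_{n₁}⋯(q;q)_{n₆}) equals 2q^{-1}/(q;q)_∞³ · ∑_{n≥1} qⁿ/(1-qⁿ) − q^{-1}/(q;q)_∞³ + q^{-1}/(q;q)_∞². -/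
namespace S12
open Filter Topology

lemma pow_bd {q : ℂ} (hq : ‖q‖ < 1) (i : ℕ) : ‖q ^ (i+1)‖ < 1 := by
  rw [norm_pow]; exact pow_lt_one₀ (norm_nonneg _) hq (by omega)

lemma one_sub_ne {q : ℂ} (hq : ‖q‖ < 1) (i : ℕ) : 1 - q ^ (i+1) ≠ 0 := by
  intro h
  have := pow_bd hq i
  rw [← sub_eq_zero.mp h] at this
  simp at this

lemma poch_ne {q : ℂ} (hq : ‖q‖ < 1) (n : ℕ) : qPoch q n ≠ 0 := by
  unfold qPoch
  exact Finset.prod_ne_zero_iff.mpr fun i _ => one_sub_ne hq i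

lemma poch_succ (q : ℂ) (n : ℕ) : qPoch q (n+1) = qPoch q n * (1 - q^(n+1)) := by
  unfold qPoch; rw [Finset.prod_range_succ]

lemma poch_zero (q : ℂ) : qPoch q 0 = 1 := by simp [qPoch]

lemma summ_norm {q : ℂ} (hq : ‖q‖ < 1) : Summable fun i : ℕ => ‖-q^(i+1)‖ := by
  have := (summable_geometric_of_lt_one (norm_nonneg q) hq).mul_left ‖q‖
  refine this.congr fun i => ?_
  rw [norm_neg, norm_pow, pow_succ, mul_comm]

lemma inf_ne {q : ℂ} (hq : ‖q‖ < 1) : qPochInf q ≠ 0 := by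
  unfold qPochInf
  have := tprod_one_add_ne_zero_of_summable (f := fun i : ℕ => -q^(i+1))
    (fun i => by simpa [sub_eq_add_neg] using one_sub_ne hq i) (summ_norm hq)
  simpa [sub_eq_add_neg] using this

lemma poch_tendsto {q : ℂ} (hq : ‖q‖ < 1) : Tendsto (qPoch q) atTop (𝓝 (qPochInf q)) := by
  have := (multipliable_one_add_of_summable (summ_norm hq)).hasProd.tendsto_prod_nat
  have h2 : qPoch q = fun n => ∏ i ∈ Finset.range n, (1 + -q^(i+1)) := by
    funext n; simp [qPoch, sub_eq_add_neg]
  rw [h2]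
  simpa [sub_eq_add_neg, qPochInf] using this

lemma exists_bd {q : ℂ} (hq : ‖q‖ < 1) : ∃ C : ℝ, 0 ≤ C ∧ ∀ n, ‖(qPoch q n)⁻¹‖ ≤ C := by
  have h := (poch_tendsto hq).inv₀ (inf_ne hq)
  obtain ⟨C, hC⟩ := (Metric.isBounded_range_of_tendsto _ h).exists_norm_le
  refine ⟨C, (norm_nonneg _).trans (hC _ ⟨0, rfl⟩), fun n => hC _ ⟨n, rfl⟩⟩

lemma u_diff {q : ℂ} (hq : ‖q‖ < 1) (n : ℕ) :
    (qPoch q (n+1))⁻¹ - (qPoch q n)⁻¹ = q^(n+1) * (qPoch q (n+1))⁻¹ := by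
  have h1 := poch_ne hq n
  have h2 := one_sub_ne hq n
  rw [poch_succ]; field_simp; ring

lemma key_pow_bd {r : ℝ} (h0 : 0 ≤ r) (h1 : r ≤ 1) (n k : ℕ) (hk : k ≠ 0) :
    r^((n+1)*k) ≤ r^n * r^k := by
  rw [← pow_add]
  apply pow_le_pow_of_le_one h0 h1
  obtain ⟨k, rfl⟩ := Nat.exists_eq_succ_of_ne_zero hk
  simp only [Nat.succ_eq_add_one]; nlinarith [Nat.zero_le (n*k)]

/-- general limit/bound: weighted sums -/
lemma W_summ {q : ℂ} (hq : ‖q‖ < 1) (j n : ℕ) :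
    Summable fun k : ℕ => (k:ℂ)^j * q^((n+1)*k) * (qPoch q k)⁻¹ := by
  obtain ⟨C, hC0, hC⟩ := exists_bd hq
  have hs := (summable_pow_mul_geometric_of_norm_lt_one (R := ℝ) j
    (r := ‖q‖) (by simpa using hq)).mul_right C
  refine Summable.of_norm_bounded hs fun k => ?_
  rw [norm_mul, norm_mul, norm_pow, norm_pow, Complex.norm_natCast]
  refine mul_le_mul (mul_le_mul_of_nonneg_left ?_ (by positivity)) (hC k) (norm_nonneg _) (by positivity)
  exact pow_le_pow_of_le_one (norm_nonneg _) hq.le (by nlinarith [Nat.zero_le (n*k)])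

lemma W_tendsto {q : ℂ} (hq : ‖q‖ < 1) (j : ℕ) :
    Tendsto (fun n : ℕ => ∑' k : ℕ, (k:ℂ)^j * q^((n+1)*k) * (qPoch q k)⁻¹) atTop
      (𝓝 ((0:ℂ)^j)) := by
  obtain ⟨C, hC0, hC⟩ := exists_bd hq
  have hs := (summable_pow_mul_geometric_of_norm_lt_one (R := ℝ) j
    (r := ‖q‖) (by simpa using hq)).mul_right C
  have := tendsto_tsum_of_dominated_convergence (𝓕 := atTop)
    (f := fun n k : ℕ => (k:ℂ)^j * q^((n+1)*k) * (qPoch q k)⁻¹)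
    (g := fun k : ℕ => if k = 0 then (0:ℂ)^j else 0) hs ?_ ?_
  · simpa using this
  · intro k
    split_ifs with hk
    · subst hk; simp [poch_zero]
    · have h1 : Tendsto (fun n : ℕ => (q^k)^(n+1)) atTop (𝓝 0) := by
        refine (tendsto_add_atTop_iff_nat (f := fun n => (q^k)^n) 1).mpr ?_
        apply tendsto_pow_atTop_nhds_zero_of_norm_lt_one
        rw [norm_pow]; exact pow_lt_one₀ (norm_nonneg _) hq hk
      have := (h1.const_mul ((k:ℂ)^j)).mul_const (qPoch q k)⁻¹
      simpa [← pow_mul, mul_comm k] using this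
  · refine Eventually.of_forall fun n k => ?_
    rw [norm_mul, norm_mul, norm_pow, norm_pow, Complex.norm_natCast]
    refine mul_le_mul (mul_le_mul_of_nonneg_left ?_ (by positivity)) (hC k) (norm_nonneg _) (by positivity)
    exact pow_le_pow_of_le_one (norm_nonneg _) hq.le (by nlinarith [Nat.zero_le (n*k)])

noncomputable def G (q : ℂ) (n : ℕ) : ℂ := ∑' k : ℕ, q^((n+1)*k) * (qPoch q k)⁻¹
noncomputable def H (q : ℂ) (n : ℕ) : ℂ := ∑' k : ℕ, (k:ℂ) * q^((n+1)*k) * (qPoch q k)⁻¹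

lemma G_summ {q : ℂ} (hq : ‖q‖ < 1) (n : ℕ) : Summable fun k : ℕ => q^((n+1)*k) * (qPoch q k)⁻¹ := by
  simpa using W_summ hq 0 n
lemma H_summ {q : ℂ} (hq : ‖q‖ < 1) (n : ℕ) : Summable fun k : ℕ => (k:ℂ) * q^((n+1)*k) * (qPoch q k)⁻¹ := by
  simpa using W_summ hq 1 n
lemma G_tendsto {q : ℂ} (hq : ‖q‖ < 1) : Tendsto (G q) atTop (𝓝 1) := by
  refine Tendsto.congr (fun n => ?_) (by simpa using W_tendsto hq 0)
  simp [G]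
lemma H_tendsto {q : ℂ} (hq : ‖q‖ < 1) : Tendsto (H q) atTop (𝓝 0) := by
  refine Tendsto.congr (fun n => ?_) (by simpa using W_tendsto hq 1)
  simp [H]

lemma step {q : ℂ} (hq : ‖q‖ < 1) (n k : ℕ) :
    q^((n+1)*(k+1)) * (qPoch q (k+1))⁻¹ - q^((n+1+1)*(k+1)) * (qPoch q (k+1))⁻¹
      = q^(n+1) * (q^((n+1)*k) * (qPoch q k)⁻¹) := by
  have h1 := poch_ne hq k
  have h2 := one_sub_ne hq k
  rw [poch_succ]; field_simp; ring

lemma G_rec {q : ℂ} (hq : ‖q‖ < 1) (n : ℕ) : G q (n+1) = (1 - q^(n+1)) * G q n := by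
  have : G q n - G q (n+1) = q^(n+1) * G q n := by
    unfold G
    rw [← (G_summ hq n).tsum_sub (G_summ hq (n+1)),
      ((G_summ hq n).sub (G_summ hq (n+1))).tsum_eq_zero_add, ← tsum_mul_left]
    simp only [step hq]
    simp
  linear_combination -this

lemma H_rec {q : ℂ} (hq : ‖q‖ < 1) (n : ℕ) :
    H q (n+1) = (1 - q^(n+1)) * H q n - q^(n+1) * G q n := by
  have : H q n - H q (n+1) = q^(n+1) * (H q n + G q n) := by
    unfold H G
    rw [← (H_summ hq n).tsum_sub (H_summ hq (n+1)),
      ((H_summ hq n).sub (H_summ hq (n+1))).tsum_eq_zero_add, ← (H_summ hq n).tsum_add (G_summ hq n),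
      ← tsum_mul_left]
    have : ∀ k : ℕ, ((k+1:ℕ):ℂ) * q^((n+1)*(k+1)) * (qPoch q (k+1))⁻¹
      - ((k+1:ℕ):ℂ) * q^((n+1+1)*(k+1)) * (qPoch q (k+1))⁻¹
      = q^(n+1) * ((k:ℂ) * q^((n+1)*k) * (qPoch q k)⁻¹ + q^((n+1)*k) * (qPoch q k)⁻¹) := by
      intro k
      have := step hq n k
      push_cast
      linear_combination ((k:ℂ)+1) * this
    simp only [this]
    simp
  linear_combination -this

lemma G_eq0 {q : ℂ} (hq : ‖q‖ < 1) (n : ℕ) : G q n = qPoch q n * G q 0 := by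
  induction n with
  | zero => simp [poch_zero]
  | succ n ih => rw [G_rec hq, ih, poch_succ]; ring

lemma G_zero {q : ℂ} (hq : ‖q‖ < 1) : G q 0 = (qPochInf q)⁻¹ := by
  have h1 := (poch_tendsto hq).mul_const (G q 0)
  have h2 := (G_tendsto hq).congr (G_eq0 hq)
  have := tendsto_nhds_unique h1 h2
  exact eq_inv_of_mul_eq_one_right this

lemma G_eq {q : ℂ} (hq : ‖q‖ < 1) (n : ℕ) : G q n = qPoch q n * (qPochInf q)⁻¹ := by
  rw [G_eq0 hq, G_zero hq]

lemma L_summ {q : ℂ} (hq : ‖q‖ < 1) : Summable fun n : ℕ => q^(n+1) / (1 - q^(n+1)) := by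
  refine Summable.of_norm_bounded
    (g := fun n : ℕ => ‖q‖^n * (1-‖q‖)⁻¹)
    ((summable_geometric_of_lt_one (norm_nonneg q) hq).mul_right _) fun n => ?_
  rw [norm_div, div_eq_mul_inv]
  have h1 : 1 - ‖q‖ ≤ ‖1 - q^(n+1)‖ := by
    have := norm_sub_norm_le (1:ℂ) (q^(n+1))
    rw [norm_one, norm_pow] at this
    have h2 : ‖q‖^(n+1) ≤ ‖q‖ := pow_le_of_le_one (norm_nonneg _) hq.le (by omega)
    linarith
  have h3 : 0 < 1 - ‖q‖ := by linarith
  rw [norm_pow]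
  refine mul_le_mul (pow_le_pow_of_le_one (norm_nonneg _) hq.le (by omega))
    (inv_anti₀ h3 h1) (by positivity) (by positivity)

lemma H_partial {q : ℂ} (hq : ‖q‖ < 1) (n : ℕ) :
    H q n = qPoch q n * (H q 0 - (qPochInf q)⁻¹ * ∑ i ∈ Finset.range n, q^(i+1)/(1-q^(i+1))) := by
  induction n with
  | zero => simp [poch_zero]
  | succ n ih =>
    rw [H_rec hq, ih, G_eq hq, Finset.sum_range_succ, poch_succ]
    have := one_sub_ne hq n
    field_simp
    ring

lemma H_zero {q : ℂ} (hq : ‖q‖ < 1) :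
    H q 0 = (qPochInf q)⁻¹ * ∑' i : ℕ, q^(i+1)/(1-q^(i+1)) := by
  have h1 := (poch_tendsto hq).mul
    (((L_summ hq).hasSum.tendsto_sum_nat.const_mul (qPochInf q)⁻¹).const_sub (H q 0))
  have h2 := (H_tendsto hq).congr (H_partial hq)
  have := tendsto_nhds_unique h1 h2
  have := (mul_eq_zero.mp this).resolve_left (inf_ne hq)
  exact sub_eq_zero.mp this

lemma D_bd {q : ℂ} (hq : ‖q‖ < 1) : ∃ C : ℝ, ∀ n,
    ‖(qPochInf q)⁻¹ - (qPoch q n)⁻¹‖ ≤ C * ‖q‖^n := by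
  obtain ⟨C, hC0, hC⟩ := exists_bd hq
  refine ⟨C / (1 - ‖q‖), fun n => ?_⟩
  have := dist_le_of_le_geometric_of_tendsto (f := fun n => (qPoch q n)⁻¹) ‖q‖ C hq ?_
    ((poch_tendsto hq).inv₀ (inf_ne hq)) n
  · rw [dist_comm, dist_eq_norm] at this
    refine this.trans_eq (by ring)
  · intro n
    rw [dist_comm, dist_eq_norm, u_diff hq, norm_mul, norm_pow, mul_comm]
    exact mul_le_mul (hC _) (pow_le_pow_of_le_one (norm_nonneg _) hq.le (by omega)) (by positivity) hC0

lemma D_summ {q : ℂ} (hq : ‖q‖ < 1) :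
    Summable fun n => (qPochInf q)⁻¹ - (qPoch q n)⁻¹ := by
  obtain ⟨C, hC⟩ := D_bd hq
  exact Summable.of_norm_bounded
    ((summable_geometric_of_lt_one (norm_nonneg q) hq).mul_left C) hC

lemma D_partial {q : ℂ} (hq : ‖q‖ < 1) (N : ℕ) :
    ∑ m ∈ Finset.range (N+1), ((qPochInf q)⁻¹ - (qPoch q m)⁻¹) =
      ∑ k ∈ Finset.range (N+1), (k:ℂ) * q^((0+1)*k) * (qPoch q k)⁻¹
        + ((N:ℂ)+1) * ((qPochInf q)⁻¹ - (qPoch q N)⁻¹) := by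
  induction N with
  | zero => simp
  | succ N ih =>
    rw [Finset.sum_range_succ, ih, Finset.sum_range_succ _ (N+1)]
    have := u_diff hq N
    push_cast
    simp only [zero_add, one_mul]
    linear_combination ((N:ℂ)+1) * this

lemma D_tsum {q : ℂ} (hq : ‖q‖ < 1) :
    ∑' n, ((qPochInf q)⁻¹ - (qPoch q n)⁻¹) = H q 0 := by
  have h1 := (tendsto_add_atTop_iff_nat 1).mpr (D_summ hq).hasSum.tendsto_sum_nat
  have h2 := (tendsto_add_atTop_iff_nat 1).mpr (H_summ hq 0).hasSum.tendsto_sum_nat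
  have h3 : Tendsto (fun N : ℕ => ((N:ℂ)+1) * ((qPochInf q)⁻¹ - (qPoch q N)⁻¹)) atTop (𝓝 0) := by
    obtain ⟨C, hC⟩ := D_bd hq
    have ha := (tendsto_self_mul_const_pow_of_lt_one (norm_nonneg q) hq).add
      (tendsto_pow_atTop_nhds_zero_of_lt_one (norm_nonneg q) hq)
    have hb := ha.const_mul C
    simp only [add_zero, mul_zero] at hb
    refine squeeze_zero_norm (fun N => ?_) hb
    rw [norm_mul]
    have : ‖(N:ℂ)+1‖ = (N:ℝ)+1 := by
      have := Complex.norm_natCast (N+1); push_cast at this; exact this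
    rw [this]
    calc _ ≤ ((N:ℝ)+1) * (C * ‖q‖^N) := mul_le_mul_of_nonneg_left (hC N) (by positivity)
      _ = _ := by ring
  have h4 := (h2.add h3).congr (fun N => (D_partial hq N).symm)
  rw [add_zero] at h4
  exact tendsto_nhds_unique h1 h4

/-- the double sum, inner part -/
lemma inner_sum {q : ℂ} (hq : ‖q‖ < 1) (c : ℕ) :
    ∑' d : ℕ, q^((c+1)*(d+1)) * (qPoch q (d+1))⁻¹ = qPoch q c * (qPochInf q)⁻¹ - 1 := by
  have h := G_eq hq c
  unfold G at h
  rw [(G_summ hq c).tsum_eq_zero_add] at h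
  simp only [poch_zero, mul_zero, pow_zero, inv_one, mul_one] at h
  linear_combination h

lemma double_sum {q : ℂ} (hq : ‖q‖ < 1) :
    ∑' c : ℕ, ((qPoch q (c+1))⁻¹ * ∑' d : ℕ, q^((c+1)*(d+1)) * (qPoch q (d+1))⁻¹)
      = 2 * (qPochInf q)⁻¹ * (∑' i : ℕ, q^(i+1)/(1-q^(i+1))) - (qPochInf q)⁻¹ + 1 := by
  have hD := D_tsum hq
  rw [(D_summ hq).tsum_eq_zero_add, H_zero hq, poch_zero] at hD
  have : ∀ c : ℕ, ((qPoch q (c+1))⁻¹ * ∑' d : ℕ, q^((c+1)*(d+1)) * (qPoch q (d+1))⁻¹)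
      = (qPochInf q)⁻¹ * (q^(c+1)/(1-q^(c+1))) + ((qPochInf q)⁻¹ - (qPoch q (c+1))⁻¹) := by
    intro c
    rw [inner_sum hq, poch_succ]
    have h1 := poch_ne hq c
    have h2 := one_sub_ne hq c
    have h3 := inf_ne hq
    field_simp
    ring
  simp only [this]
  rw [((L_summ hq).mul_left _).tsum_add ((summable_nat_add_iff 1).mpr (D_summ hq)), tsum_mul_left]
  rw [inv_one] at hD
  linear_combination hD

def e6 : (ℕ × ℕ × ℕ × ℕ × ℕ × ℕ) ≃ (Fin 6 → ℕ) where
  toFun p := ![p.2.2.2.2.1, p.2.2.1, p.1, p.2.1, p.2.2.2.1, p.2.2.2.2.2]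
  invFun n := (n 2, n 3, n 1, n 4, n 0, n 5)
  left_inv p := rfl
  right_inv n := by ext i; fin_cases i <;> rfl

/-- the summand in the new coordinates -/
noncomputable def F (q : ℂ) (p : ℕ × ℕ × ℕ × ℕ × ℕ × ℕ) : ℂ :=
  q ^ (p.2.2.2.2.1 + p.2.2.1 + p.1 + p.2.1 + p.2.2.2.1 + p.2.2.2.2.2 + p.2.2.2.2.1 * p.2.2.1
    + p.2.2.1 * p.1 + p.1 * p.2.1 + p.2.1 * p.2.2.2.1 + p.2.2.2.1 * p.2.2.2.2.2)
   / (qPoch q p.2.2.2.2.1 * qPoch q p.2.2.1 * qPoch q p.1 * qPoch q p.2.1 * qPoch q p.2.2.2.1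
      * qPoch q p.2.2.2.2.2)

lemma F_summ {q : ℂ} (hq : ‖q‖ < 1) : Summable (F q) := by
  obtain ⟨C, hC0, hC⟩ := exists_bd hq
  have s : Summable fun n : ℕ => C * ‖q‖^n :=
    (summable_geometric_of_lt_one (norm_nonneg q) hq).mul_left C
  have p : (0 : ℕ → ℝ) ≤ fun n : ℕ => C * ‖q‖^n := fun n => by simp only [Pi.zero_apply]; positivity
  have s2 := s.mul_of_nonneg s p p
  have p2 : (0 : ℕ × ℕ → ℝ) ≤ _ := fun x => mul_nonneg (p x.1) (p x.2)
  have s3 := s.mul_of_nonneg s2 p p2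
  have p3 : (0 : ℕ × ℕ × ℕ → ℝ) ≤ _ := fun x => mul_nonneg (p x.1) (p2 x.2)
  have s4 := s.mul_of_nonneg s3 p p3
  have p4 : (0 : ℕ × ℕ × ℕ × ℕ → ℝ) ≤ _ := fun x => mul_nonneg (p x.1) (p3 x.2)
  have s5 := s.mul_of_nonneg s4 p p4
  have p5 : (0 : ℕ × ℕ × ℕ × ℕ × ℕ → ℝ) ≤ _ := fun x => mul_nonneg (p x.1) (p4 x.2)
  have s6 := s.mul_of_nonneg s5 p p5
  refine Summable.of_norm_bounded s6 ?_
  rintro ⟨c, d, b, e, a, f⟩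
  simp only [F]
  rw [div_eq_mul_inv]
  simp only [mul_inv, norm_mul, norm_pow]
  calc _ ≤ ‖q‖^(a+b+c+d+e+f) * (C*C*C*C*C*C) := by
        gcongr ?_ * (?_ * ?_ * ?_ * ?_ * ?_ * ?_)
        any_goals exact hC _
        exact pow_le_pow_of_le_one (norm_nonneg _) hq.le (by omega)
    _ = _ := by ring

lemma G_form {q : ℂ} (hq : ‖q‖ < 1) (b : ℕ) :
    ∑' a : ℕ, q^(a + a*b) / qPoch q a = qPoch q b * (qPochInf q)⁻¹ := by
  rw [← G_eq hq]; unfold G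
  refine tsum_congr fun a => ?_
  rw [div_eq_mul_inv]; congr 2; ring

lemma geo_form {q : ℂ} (hq : ‖q‖ < 1) (c : ℕ) :
    ∑' b : ℕ, q^(b + b*c) = (1 - q^(c+1))⁻¹ := by
  rw [← tsum_geometric_of_norm_lt_one (pow_bd hq c)]
  refine tsum_congr fun a => ?_
  rw [← pow_mul]; congr 1; ring

lemma F_tsum {q : ℂ} (hq : ‖q‖ < 1) (hq0 : q ≠ 0) : ∑' p, F q p =
    (qPochInf q)⁻¹^2 * q⁻¹ *
    ∑' c : ℕ, ((qPoch q (c+1))⁻¹ * ∑' d : ℕ, q^((c+1)*(d+1)) * (qPoch q (d+1))⁻¹) := by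
  have s := F_summ hq
  rw [s.tsum_prod, ← tsum_mul_left]
  refine tsum_congr fun c => ?_
  have s1 := s.prod_factor c
  rw [s1.tsum_prod, ← tsum_mul_left, ← tsum_mul_left]
  refine tsum_congr fun d => ?_
  have s2 := s1.prod_factor d
  have key : ∀ b e, ∑' x : ℕ × ℕ, F q (c, d, b, e, x) =
      (q^(c+d+c*d) / (qPoch q c * qPoch q d) * (qPochInf q)⁻¹^2) * (q^(b+b*c) * q^(e+e*d)) := by
    intro b e
    have s4 := (s2.prod_factor b).prod_factor e
    rw [s4.tsum_prod]
    have : ∀ a f, F q (c, d, b, e, a, f) =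
        (q^(c+d+c*d) * q^(b+b*c) * q^(e+e*d)/ (qPoch q c * qPoch q d * qPoch q b * qPoch q e)) *
        ((q^(a+a*b)/qPoch q a) * (q^(f + f*e) / qPoch q f)) := by
      intro a f
      have ha := poch_ne hq a
      have hb := poch_ne hq b
      have hc := poch_ne hq c
      have hd := poch_ne hq d
      have he := poch_ne hq e
      have hf := poch_ne hq f
      simp only [F]
      field_simp
      simp only [← pow_add]
      congr 1; ring
    simp only [this, tsum_mul_left, tsum_mul_right, G_form hq]
    have hb := poch_ne hq b
    have he := poch_ne hq e
    field_simp
  rw [s2.tsum_prod]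
  have : ∀ b, ∑' x : ℕ × ℕ × ℕ, F q (c, d, b, x) =
      ∑' e, (q^(c+d+c*d) / (qPoch q c * qPoch q d) * (qPochInf q)⁻¹^2) * (q^(b+b*c) * q^(e+e*d)) := by
    intro b
    rw [(s2.prod_factor b).tsum_prod]
    exact tsum_congr fun e => key b e
  simp only [this, tsum_mul_left, tsum_mul_right, geo_form hq]
  rw [poch_succ, poch_succ]
  have hc := poch_ne hq c
  have hd := poch_ne hq d
  have hc' := one_sub_ne hq c
  have hd' := one_sub_ne hq d
  have : q^((c+1)*(d+1)) = q * q^(c+d+c*d) := by rw [← pow_succ']; congr 1; ring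
  rw [this]
  field_simp

end S12

theorem stmt12 (q : ℂ) (hq : ‖q‖ < 1) (hq0 : q ≠ 0) :
    ∑' n : Fin 6 → ℕ,
        q ^ (n 0 + n 1 + n 2 + n 3 + n 4 + n 5 +
              n 0 * n 1 + n 1 * n 2 + n 2 * n 3 + n 3 * n 4 + n 4 * n 5)
          / (qPoch q (n 0) * qPoch q (n 1) * qPoch q (n 2) * qPoch q (n 3) *
              qPoch q (n 4) * qPoch q (n 5))
      = 2 * q⁻¹ / qPochInf q ^ 3 * (∑' n : ℕ, q ^ (n + 1) / (1 - q ^ (n + 1)))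
          - q⁻¹ / qPochInf q ^ 3 + q⁻¹ / qPochInf q ^ 2 := by
  rw [← S12.e6.tsum_eq]
  refine (S12.F_tsum hq hq0).trans ?_
  rw [S12.double_sum hq]
  have := S12.inf_ne hq
  field_simp
end

section
/- For every integer k ≥ 1, the number of tuples (n₁,…,n_{2k+1}) of nonnegative integers satisfying ∑_{i=1}^{2k+1} n_i² − ∑_{i=1}^{2k} n_i n_{i+1} = 1 is (2k+1)(k+1), and the number satisfying ∑_{i=1}^{2k+1} n_i² − ∑_{i=1}^{2k} n_i n_{i+1} = 2 is 2·C(2k+2, 4). -/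
/-- The quadratic form `Q(n) = ∑_{i=1}^{2k+1} n_i² − ∑_{i=1}^{2k} n_i n_{i+1}` (over ℤ). -/
def Qform (k : ℕ) (n : Fin (2 * k + 1) → ℕ) : ℤ :=
  (∑ i, (n i : ℤ) ^ 2) - ∑ i : Fin (2 * k), (n i.castSucc : ℤ) * (n i.succ : ℤ)

def En : (m : ℕ) → ℕ → (Fin m → ℕ) → ℤ
  | 0, h, _ => (h : ℤ) ^ 2
  | m + 1, h, n => ((n 0 : ℤ) - h) ^ 2 + En m (n 0) (Fin.tail n)

noncomputable def Nn (m h : ℕ) (e : ℤ) : ℕ∞ := {n : Fin m → ℕ | En m h n = e}.encard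

theorem le_En (m : ℕ) : ∀ (h : ℕ) (n : Fin m → ℕ), (h : ℤ) ≤ En m h n := by
  induction m with
  | zero => intro h n; simp only [En]; nlinarith [Int.le_self_sq (h : ℤ)]
  | succ m ih =>
    intro h n
    simp only [En]
    have h1 := ih (n 0) (Fin.tail n)
    have h2 := Int.le_self_sq ((h : ℤ) - n 0)
    nlinarith

theorem Nn_zero (m h : ℕ) (e : ℤ) (he : e < h) : Nn m h e = 0 := by
  rw [Nn, Set.encard_eq_zero, Set.eq_empty_iff_forall_notMem]
  intro n hn
  have := le_En m h n
  simp only [Set.mem_ofPred_eq] at hn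
  omega

theorem cons_encard (m x h : ℕ) (e : ℤ) :
    {n : Fin (m + 1) → ℕ | n 0 = x ∧ En (m + 1) h n = e}.encard
      = Nn m x (e - ((x : ℤ) - h) ^ 2) := by
  rw [Nn, ← (Fin.cons_right_injective (α := fun _ => ℕ) x).encard_image
    {n : Fin m → ℕ | En m x n = e - ((x : ℤ) - h) ^ 2}]
  refine congrArg Set.encard ?_
  ext n
  simp only [Set.mem_ofPred_eq, Set.mem_image, En]
  constructor
  · rintro ⟨rfl, hn⟩
    exact ⟨Fin.tail n, by linarith, Fin.cons_self_tail n⟩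
  · rintro ⟨n, hn, rfl⟩
    simp only [Fin.cons_zero, Fin.tail_cons, true_and]
    linarith

theorem rec_zero (m : ℕ) (e : ℤ) (he : e ≤ 4) :
    Nn (m + 1) 0 e = Nn m 0 e + Nn m 1 (e - 1) := by
  have h0 := cons_encard m 0 0 e
  have h1 := cons_encard m 1 0 e
  norm_num at h0 h1
  rw [← h0, ← h1, Nn, ← Set.encard_union_eq]
  · congr 1
    ext n
    simp only [Set.mem_ofPred_eq, Set.mem_union]
    constructor
    · intro hn
      have : n 0 < 2 := by
        by_contra hc
        have h3 := le_En m (n 0) (Fin.tail n)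
        simp only [En] at hn
        push_cast at hn
        have : (2 : ℤ) ≤ n 0 := by exact_mod_cast not_lt.mp hc
        nlinarith
      rcases (by omega : n 0 = 0 ∨ n 0 = 1) with h | h <;> simp [h, hn]
    · tauto
  · rw [Set.disjoint_left]
    simp only [Set.mem_ofPred_eq]
    omega

theorem rec_succ (m h : ℕ) (e : ℤ) (he : e ≤ 3) :
    Nn (m + 1) (h + 1) e = Nn m (h + 1) e + Nn m h (e - 1) + Nn m (h + 2) (e - 1) := by
  have h0 := cons_encard m (h + 1) (h + 1) e
  have h1 := cons_encard m h (h + 1) e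
  have h2 := cons_encard m (h + 2) (h + 1) e
  rw [show e - (((h + 1 : ℕ) : ℤ) - ((h + 1 : ℕ) : ℤ)) ^ 2 = e by ring] at h0
  rw [show e - ((h : ℤ) - ((h + 1 : ℕ) : ℤ)) ^ 2 = e - 1 by push_cast; ring] at h1
  rw [show e - (((h + 2 : ℕ) : ℤ) - ((h + 1 : ℕ) : ℤ)) ^ 2 = e - 1 by push_cast; ring] at h2
  rw [← h0, ← h1, ← h2, Nn, ← Set.encard_union_eq, ← Set.encard_union_eq]
  · congr 1
    ext n
    simp only [Set.mem_ofPred_eq, Set.mem_union]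
    constructor
    · intro hn
      have h3 := le_En m (n 0) (Fin.tail n)
      have hn2 := hn
      simp only [En] at hn2
      have h4 : ((n 0 : ℤ) - ((h + 1 : ℕ) : ℤ)) ^ 2 ≤ 3 := by
        have : (0 : ℤ) ≤ n 0 := by positivity
        linarith
      have h5 : (n 0 : ℤ) - ((h + 1 : ℕ) : ℤ) < 2 := by nlinarith
      have h6 : -2 < (n 0 : ℤ) - ((h + 1 : ℕ) : ℤ) := by nlinarith
      rcases (by omega : n 0 = h ∨ n 0 = h + 1 ∨ n 0 = h + 2) with h | h | h <;> simp [h, hn]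
    · tauto
  · rw [Set.disjoint_left]
    simp only [Set.mem_ofPred_eq, Set.mem_union]
    omega
  · rw [Set.disjoint_left]
    simp only [Set.mem_ofPred_eq]
    omega

theorem base (h : ℕ) (e : ℤ) (he : (h : ℤ) ^ 2 ≠ e) : Nn 0 h e = 0 := by
  rw [Nn, Set.encard_eq_zero, Set.eq_empty_iff_forall_notMem]
  intro n hn
  exact he hn

theorem base1 (h : ℕ) (e : ℤ) (he : (h : ℤ) ^ 2 = e) : Nn 0 h e = 1 := by
  rw [Nn, Set.encard_eq_one]
  refine ⟨Fin.elim0, ?_⟩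
  ext n
  simp [En, he, Subsingleton.elim n Fin.elim0]

theorem N00 (m : ℕ) : Nn m 0 0 = 1 := by
  induction m with
  | zero => exact base1 _ _ (by norm_num)
  | succ m ih => rw [rec_zero _ _ (by norm_num), ih, Nn_zero m 1 _ (by norm_num)]; simp

theorem N11 (m : ℕ) : Nn m 1 1 = ((m + 1 : ℕ) : ℕ∞) := by
  induction m with
  | zero => rw [base1 _ _ (by norm_num)]; simp
  | succ m ih =>
    rw [rec_succ m 0 _ (by norm_num)]
    norm_num only
    rw [ih, N00, Nn_zero m 2 _ (by norm_num)]; simp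

theorem N02 (m : ℕ) : Nn m 0 2 = (((m + 1).choose 2 : ℕ) : ℕ∞) := by
  induction m with
  | zero => rw [base _ _ (by norm_num)]; simp
  | succ m ih =>
    rw [rec_zero _ _ (by norm_num)]
    norm_num only
    rw [ih, N11, ← Nat.cast_add, Nat.choose_succ_succ' (m + 1) 1, Nat.choose_one_right, add_comm]

theorem N22 (m : ℕ) : Nn m 2 2 = (((m + 1).choose 2 : ℕ) : ℕ∞) := by
  induction m with
  | zero => rw [base _ _ (by norm_num)]; simp
  | succ m ih =>
    rw [rec_succ m 1 _ (by norm_num)]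
    norm_num only
    rw [ih, N11, Nn_zero m 3 _ (by norm_num), add_zero, ← Nat.cast_add,
      Nat.choose_succ_succ' (m + 1) 1, Nat.choose_one_right, add_comm]

theorem N13 (m : ℕ) : Nn m 1 3 = ((2 * (m + 1).choose 3 : ℕ) : ℕ∞) := by
  induction m with
  | zero => rw [base _ _ (by norm_num)]; simp [Nat.choose]
  | succ m ih =>
    rw [rec_succ m 0 _ (by norm_num)]
    norm_num only
    rw [ih, N02, N22, ← Nat.cast_add, ← Nat.cast_add, Nat.choose_succ_succ' (m + 1) 2]
    congr 1
    ring

theorem N04 (m : ℕ) : Nn m 0 4 = ((2 * (m + 1).choose 4 : ℕ) : ℕ∞) := by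
  induction m with
  | zero => rw [base _ _ (by norm_num)]; simp [Nat.choose]
  | succ m ih =>
    rw [rec_zero m _ (by norm_num)]
    norm_num only
    rw [ih, N13, ← Nat.cast_add, Nat.choose_succ_succ' (m + 1) 3]
    congr 1
    ring

theorem En_eq (m : ℕ) : ∀ (h : ℕ) (n : Fin (m + 1) → ℕ), En (m + 1) h n =
    (h : ℤ) ^ 2 - 2 * h * n 0 + 2 * ((∑ i, (n i : ℤ) ^ 2)
      - ∑ i : Fin m, (n i.castSucc : ℤ) * (n i.succ : ℤ)) := by
  induction m with
  | zero => intro h n; simp [En]; ring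
  | succ m ih =>
    intro h n
    rw [En, ih, Fin.sum_univ_succ (n := m + 1),
      Fin.sum_univ_succ (n := m) (fun i => (n i.castSucc : ℤ) * (n i.succ : ℤ))]
    simp only [Fin.tail, Fin.succ_castSucc, Fin.castSucc_zero]
    ring

theorem Q_ncard (k : ℕ) (e : ℤ) (c : ℕ) (h : Nn (2 * k + 1) 0 (2 * e) = (c : ℕ∞)) :
    {n : Fin (2 * k + 1) → ℕ | Qform k n = e}.ncard = c := by
  rw [Set.ncard]
  have : {n : Fin (2 * k + 1) → ℕ | Qform k n = e}
      = {n | En (2 * k + 1) 0 n = 2 * e} := by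
    ext n
    simp only [Set.mem_ofPred_eq, En_eq, Qform]
    push_cast
    constructor <;> intro h <;> linarith
  rw [this]
  rw [Nn] at h
  rw [h]; simp

theorem stmt17 (k : ℕ) (hk : 1 ≤ k) :
    {n : Fin (2 * k + 1) → ℕ | Qform k n = 1}.ncard = (2 * k + 1) * (k + 1) ∧
    {n : Fin (2 * k + 1) → ℕ | Qform k n = 2}.ncard = 2 * Nat.choose (2 * k + 2) 4 := by
  constructor
  · apply Q_ncard
    have h := N02 (2 * k + 1)
    norm_num only
    rw [h]
    congr 1
    rw [Nat.choose_two_right]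
    have : (2 * k + 1 + 1) * (2 * k + 1 + 1 - 1) = 2 * ((2 * k + 1) * (k + 1)) := by
      rw [Nat.add_sub_cancel]; ring
    omega
  · apply Q_ncard
    have h := N04 (2 * k + 1)
    norm_num only
    rw [h]
end
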